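/- The even hyperbolic lattice U(2) ⊕ D₄ ⊕ D₄ ⊕ D₄ (the 2-elementary lattice with invariants (r,a,δ) = (14,8,0)) is reflective: the subgroup W_r of O(S) generated by reflections in all roots has finite index in O(S). -/

import Mathlib

open Matrix

/-- The bilinear form on `ℤⁿ` associated to a Gram matrix `G`. -/
def bform {n : ℕ} (G : Matrix (Fin n) (Fin n) ℤ) (x y : Fin n → ℤ) : ℤ :=
  x ⬝ᵥ G.mulVec y

/-- The orthogonal group `O(S)` of the lattice with Gram matrix `G`:
all `ℤ`-module automorphisms preserving the bilinear form. -/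
def OrthGroup (n : ℕ) (G : Matrix (Fin n) (Fin n) ℤ) :
    Subgroup ((Fin n → ℤ) ≃ₗ[ℤ] (Fin n → ℤ)) where
  carrier := {f | ∀ x y, bform G (f x) (f y) = bform G x y}
  one_mem' := fun _ _ => rfl
  mul_mem' := by
    intro f g hf hg x y
    exact (hf (g x) (g y)).trans (hg x y)
  inv_mem' := by
    intro f hf x y
    have h := (hf (f⁻¹ x) (f⁻¹ y)).symm
    rwa [show f (f⁻¹ x) = x from f.apply_symm_apply x,
      show f (f⁻¹ y) = y from f.apply_symm_apply y] at h

/-- A root: a vector of square `-2`, or of square `-4` whose pairing with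
the whole lattice is even. -/
def IsRoot {n : ℕ} (G : Matrix (Fin n) (Fin n) ℤ) (α : Fin n → ℤ) : Prop :=
  bform G α α = -2 ∨ (bform G α α = -4 ∧ ∀ x : Fin n → ℤ, (2 : ℤ) ∣ bform G α x)

/-- `f` is the reflection in a root `α`. -/
def IsReflection {n : ℕ} (G : Matrix (Fin n) (Fin n) ℤ)
    (f : (Fin n → ℤ) ≃ₗ[ℤ] (Fin n → ℤ)) : Prop :=
  ∃ α : Fin n → ℤ, IsRoot G α ∧
    ∀ x : Fin n → ℤ, f x = x - ((2 * bform G x α) / bform G α α) • α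

/-- The subgroup `W_r` of `O(S)` generated by the reflections in all roots. -/
def Wr (n : ℕ) (G : Matrix (Fin n) (Fin n) ℤ) : Subgroup ↥(OrthGroup n G) :=
  Subgroup.closure {f | IsReflection G f.val}

open Matrix

/-- Orthogonal direct sum of two Gram matrices. -/
def dsum {m k : ℕ} (A : Matrix (Fin m) (Fin m) ℤ) (B : Matrix (Fin k) (Fin k) ℤ) :
    Matrix (Fin (m + k)) (Fin (m + k)) ℤ :=
  Matrix.reindex finSumFinEquiv finSumFinEquiv (Matrix.fromBlocks A 0 0 B)

/-- Gram matrix of the hyperbolic plane `U`. -/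
def gramU : Matrix (Fin 2) (Fin 2) ℤ := !![0, 1; 1, 0]

/-- Gram matrix of `A₁ = ⟨-2⟩`. -/
def gramA1 : Matrix (Fin 1) (Fin 1) ℤ := !![-2]

/-- Gram matrix (= negative Cartan matrix) of a simply laced root lattice with
given Dynkin diagram edges. -/
def adjGram (n : ℕ) (E : List (ℕ × ℕ)) : Matrix (Fin n) (Fin n) ℤ :=
  Matrix.of fun i j =>
    if i = j then -2 else if (i.1, j.1) ∈ E ∨ (j.1, i.1) ∈ E then 1 else 0

/-- Gram matrix of the negative definite root lattice `Dₙ`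
(in the root basis `e₁+e₂, e₂-e₁, e₃-e₂, …, eₙ-eₙ₋₁` of `{x ∈ ℤⁿ : Σxᵢ even}`
with the negative of the standard Euclidean form). -/
def gramD (n : ℕ) : Matrix (Fin n) (Fin n) ℤ :=
  adjGram n ((0, 2) :: (List.range (n - 2)).map fun k => (k + 1, k + 2))

/-- Gram matrix (negative Cartan matrix) of `E₈`. -/
def gramE8 : Matrix (Fin 8) (Fin 8) ℤ :=
  adjGram 8 [(0, 2), (1, 3), (2, 3), (3, 4), (4, 5), (5, 6), (6, 7)]

/-- Gram matrix (negative Cartan matrix) of `E₇`. -/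
def gramE7 : Matrix (Fin 7) (Fin 7) ℤ :=
  adjGram 7 [(0, 2), (1, 3), (2, 3), (3, 4), (4, 5), (5, 6)]

/-- The Gram matrix of the even 2-elementary hyperbolic lattice `U(2) ⊕ D₄ ⊕ D₄ ⊕ D₄`,
with invariants `(r,a,δ) = (14,8,0)`. -/
def gramS :=
  dsum ((2 : ℤ) • gramU) (dsum (gramD 4) (dsum (gramD 4) (gramD 4)))

/-- The Euclidean coordinates of the three `D₄`-components of a vector. -/
def eucl (x : Fin (2 + (4 + (4 + 4))) → ℤ) : Fin 12 → ℤ :=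
  ![x 2 - x 3, x 2 + x 3 - x 4, x 4 - x 5, x 5,
    x 6 - x 7, x 6 + x 7 - x 8, x 8 - x 9, x 9,
    x 10 - x 11, x 10 + x 11 - x 12, x 12 - x 13, x 13]

theorem gramS_eq : gramS =
    !![0, 2, 0, 0, 0, 0, 0, 0, 0, 0, 0, 0, 0, 0;
      2, 0, 0, 0, 0, 0, 0, 0, 0, 0, 0, 0, 0, 0;
      0, 0, -2, 0, 1, 0, 0, 0, 0, 0, 0, 0, 0, 0;
      0, 0, 0, -2, 1, 0, 0, 0, 0, 0, 0, 0, 0, 0;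
      0, 0, 1, 1, -2, 1, 0, 0, 0, 0, 0, 0, 0, 0;
      0, 0, 0, 0, 1, -2, 0, 0, 0, 0, 0, 0, 0, 0;
      0, 0, 0, 0, 0, 0, -2, 0, 1, 0, 0, 0, 0, 0;
      0, 0, 0, 0, 0, 0, 0, -2, 1, 0, 0, 0, 0, 0;
      0, 0, 0, 0, 0, 0, 1, 1, -2, 1, 0, 0, 0, 0;
      0, 0, 0, 0, 0, 0, 0, 0, 1, -2, 0, 0, 0, 0;
      0, 0, 0, 0, 0, 0, 0, 0, 0, 0, -2, 0, 1, 0;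
      0, 0, 0, 0, 0, 0, 0, 0, 0, 0, 0, -2, 1, 0;
      0, 0, 0, 0, 0, 0, 0, 0, 0, 0, 1, 1, -2, 1;
      0, 0, 0, 0, 0, 0, 0, 0, 0, 0, 0, 0, 1, -2] := by
  decide

theorem bform_gramS (x y : Fin (2 + (4 + (4 + 4))) → ℤ) :
    bform gramS x y = 2 * (x 0 * y 1 + x 1 * y 0) - eucl x ⬝ᵥ eucl y := by
  rw [bform, gramS_eq]
  simp [eucl, dotProduct, mulVec, Fin.sum_univ_succ]
  ring

section BilinearForm

variable {n : ℕ} (G : Matrix (Fin n) (Fin n) ℤ) (x y z : Fin n → ℤ) (k : ℤ)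

theorem bform_add_left : bform G (x + y) z = bform G x z + bform G y z := by
  simp [bform]

theorem bform_smul_left : bform G (k • x) z = k * bform G x z := by
  rw [bform, bform, smul_dotProduct, smul_eq_mul]

theorem bform_neg_left : bform G (-x) z = -bform G x z := by
  simp [bform]

theorem bform_sub_left : bform G (x - y) z = bform G x z - bform G y z := by
  simp [bform, sub_dotProduct]

theorem bform_comm (hG : G.IsSymm) : bform G x y = bform G y x := by
  rw [bform, bform, dotProduct_mulVec, ← mulVec_transpose, hG, dotProduct_comm]

variable {G}

theorem dvd_bform_of_dvd_mulVec {d : ℤ} {α : Fin n → ℤ} (h : ∀ i, d ∣ G.mulVec α i) :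
    d ∣ bform G x α := by
  rw [bform, dotProduct]
  exact Finset.dvd_sum fun i _ => (h i).mul_left _

theorem IsRoot.bform_neg {α : Fin n → ℤ} (h : IsRoot G α) : bform G α α < 0 := by
  rcases h with h | ⟨h, -⟩ <;> omega

theorem IsRoot.dvd (hG : G.IsSymm) {α : Fin n → ℤ} (h : IsRoot G α) (x : Fin n → ℤ) :
    bform G α α ∣ 2 * bform G x α := by
  rcases h with h | ⟨h, h'⟩
  · rw [h]
    exact (neg_dvd.2 dvd_rfl).mul_right _
  · have := h' x
    rw [bform_comm G _ _ hG] at this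
    rw [h]
    exact neg_dvd.2 (mul_dvd_mul_left 2 this)

/-- The map `x ↦ x - (2⟨x, α⟩ / ⟨α, α⟩) • α` attached to a root `α`. -/
def reflectFun (G : Matrix (Fin n) (Fin n) ℤ) (α x : Fin n → ℤ) : Fin n → ℤ :=
  x - ((2 * bform G x α) / bform G α α) • α

theorem IsRoot.ediv_mul (hG : G.IsSymm) {α : Fin n → ℤ} (h : IsRoot G α) (x : Fin n → ℤ) :
    (2 * bform G x α) / bform G α α * bform G α α = 2 * bform G x α :=
  Int.ediv_mul_cancel (h.dvd hG x)

theorem bform_reflectFun_root (hG : G.IsSymm) {α : Fin n → ℤ} (h : IsRoot G α)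
    (x : Fin n → ℤ) : bform G (reflectFun G α x) α = -bform G x α := by
  rw [reflectFun, bform_sub_left, bform_smul_left, h.ediv_mul hG]
  ring

theorem reflectFun_reflectFun (hG : G.IsSymm) {α : Fin n → ℤ} (h : IsRoot G α)
    (x : Fin n → ℤ) : reflectFun G α (reflectFun G α x) = x := by
  conv_lhs => rw [reflectFun]
  rw [bform_reflectFun_root hG h, mul_neg, Int.neg_ediv_of_dvd (h.dvd hG x), reflectFun]
  simp

theorem bform_reflectFun (hG : G.IsSymm) {α : Fin n → ℤ} (h : IsRoot G α)
    (x y : Fin n → ℤ) : bform G (reflectFun G α x) (reflectFun G α y) = bform G x y := by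
  have hx := h.ediv_mul hG x
  have key : bform G x (reflectFun G α y) =
      bform G x y - (2 * bform G y α) / bform G α α * bform G x α := by
    rw [bform_comm _ _ _ hG, reflectFun, bform_sub_left, bform_smul_left,
      bform_comm G y x hG, bform_comm G α x hG]
  have key' : bform G α (reflectFun G α y) = -bform G y α := by
    rw [bform_comm _ _ _ hG, bform_reflectFun_root hG h]
  have hy := h.ediv_mul hG y
  have h0 := h.bform_neg.ne
  conv_lhs => rw [reflectFun]
  rw [bform_sub_left, bform_smul_left, key, key']
  refine mul_right_cancel₀ h0 ?_
  linear_combination (-bform G x α) * hy + bform G y α * hx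

/-- The reflection in a root, as an element of the orthogonal group. -/
def reflection (hG : G.IsSymm) {α : Fin n → ℤ} (h : IsRoot G α) : OrthGroup n G :=
  ⟨LinearEquiv.ofInvolutive
    { toFun := reflectFun G α
      map_add' := fun x y => by
        simp only [reflectFun, bform_add_left, mul_add, Int.add_ediv_of_dvd_left (h.dvd hG x)]
        module
      map_smul' := fun k x => by
        simp only [reflectFun, bform_smul_left, mul_left_comm, Int.mul_ediv_assoc _ (h.dvd hG x)]
        simp only [RingHom.id_apply]
        module }
    (reflectFun_reflectFun hG h), bform_reflectFun hG h⟩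

theorem reflection_mem_Wr (hG : G.IsSymm) {α : Fin n → ℤ} (h : IsRoot G α) :
    reflection hG h ∈ Wr n G :=
  Subgroup.subset_closure ⟨α, h, fun _ => rfl⟩

end BilinearForm

theorem gramS_isSymm : gramS.IsSymm := by
  rw [gramS_eq]
  decide

/-- The vectors of positive square in the positive half-cone. -/
def IsPos (x : Fin (2 + (4 + (4 + 4))) → ℤ) : Prop :=
  0 < bform gramS x x ∧ 0 < x 0

namespace IsPos

variable {x y : Fin (2 + (4 + (4 + 4))) → ℤ}

theorem one_pos (hx : IsPos x) : 0 < x 1 := by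
  obtain ⟨h, h0⟩ := hx
  rw [bform_gramS] at h
  have : 0 ≤ eucl x ⬝ᵥ eucl x := Finset.sum_nonneg fun i _ => mul_self_nonneg _
  by_contra! h1
  nlinarith

theorem bform_pos (hx : IsPos x) (hy : IsPos y) : 0 < bform gramS x y := by
  have hx1 := hx.one_pos
  have hy1 := hy.one_pos
  obtain ⟨hx, hx0⟩ := hx
  obtain ⟨hy, hy0⟩ := hy
  rw [bform_gramS] at hx hy ⊢
  have hcs : (eucl x ⬝ᵥ eucl y) ^ 2 ≤ (eucl x ⬝ᵥ eucl x) * (eucl y ⬝ᵥ eucl y) := by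
    simpa only [dotProduct, sq] using Finset.sum_mul_sq_le_sq_mul_sq Finset.univ (eucl x) (eucl y)
  have hy' : 0 ≤ eucl y ⬝ᵥ eucl y := Finset.sum_nonneg fun i _ => mul_self_nonneg _
  have h1 : (eucl x ⬝ᵥ eucl x) * (eucl y ⬝ᵥ eucl y) < (4 * (x 0 * x 1)) * (4 * (y 0 * y 1)) :=
    mul_lt_mul'' (by linarith) (by linarith)
      (Finset.sum_nonneg fun i _ => mul_self_nonneg _) hy'
  have h2 : (eucl x ⬝ᵥ eucl y) ^ 2 < (2 * (x 0 * y 1 + x 1 * y 0)) ^ 2 := by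
    nlinarith [sq_nonneg (x 0 * y 1 - x 1 * y 0)]
  linarith [lt_of_abs_lt (abs_lt_of_sq_lt_sq h2 (by positivity))]

theorem of_bform_pos (hx : IsPos x) (hy : 0 < bform gramS y y) (hxy : 0 < bform gramS x y) :
    IsPos y := by
  refine ⟨hy, ?_⟩
  by_contra! h
  rcases h.lt_or_eq with h | h
  · have hn : IsPos (-y) := by
      refine ⟨?_, by simpa using h⟩
      rwa [bform_neg_left, bform_comm _ _ _ gramS_isSymm, bform_neg_left, neg_neg]
    have := hx.bform_pos hn
    rw [bform_comm _ _ _ gramS_isSymm, bform_neg_left, bform_comm _ _ _ gramS_isSymm] at this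
    linarith
  · rw [bform_gramS, h] at hy
    have : 0 ≤ eucl y ⬝ᵥ eucl y := Finset.sum_nonneg fun i _ => mul_self_nonneg _
    linarith

theorem reflectFun {α : Fin (2 + (4 + (4 + 4))) → ℤ} (hα : IsRoot gramS α) (hx : IsPos x) :
    IsPos (reflectFun gramS α x) := by
  have h := hx.1
  refine hx.of_bform_pos (by rwa [bform_reflectFun gramS_isSymm hα]) ?_
  rw [bform_comm _ _ _ gramS_isSymm, _root_.reflectFun, bform_sub_left, bform_smul_left,
    bform_comm _ α x gramS_isSymm]
  have h1 := hα.ediv_mul gramS_isSymm x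
  have h2 := hα.bform_neg
  set q := 2 * bform gramS x α / bform gramS α α
  have : q * bform gramS x α ≤ 0 := by
    have h3 : 2 * (q * bform gramS x α) = q ^ 2 * bform gramS α α := by
      linear_combination (-q) * h1
    linarith [mul_nonpos_of_nonneg_of_nonpos (sq_nonneg q) h2.le]
  linarith

end IsPos

theorem finite_isPos_le (C : ℤ) :
    {x : Fin (2 + (4 + (4 + 4))) → ℤ | IsPos x ∧ x 0 ≤ C ∧ x 1 ≤ C}.Finite := by
  refine (Set.finite_Icc (fun _ => -(8 * C)) (fun _ => 8 * C)).subset ?_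
  rintro x ⟨hx, h0, h1⟩
  have hx1 := hx.one_pos
  obtain ⟨hn, hx0⟩ := hx
  have hb : ∀ i, |eucl x i| ≤ 2 * C := fun i => by
    refine abs_le_of_sq_le_sq ?_ (by linarith)
    have : eucl x i * eucl x i ≤ eucl x ⬝ᵥ eucl x :=
      Finset.single_le_sum (f := fun i => eucl x i * eucl x i)
        (fun i _ => mul_self_nonneg _) (Finset.mem_univ i)
    rw [bform_gramS] at hn
    nlinarith
  simp only [abs_le, Fin.forall_fin_succ, Fin.forall_fin_zero, eucl] at hb
  simp [Fin.succ] at hb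
  have key : ∀ i, -(8 * C) ≤ x i ∧ x i ≤ 8 * C := by
    intro i
    fin_cases i <;> simp <;> omega
  exact ⟨fun i => (key i).1, fun i => (key i).2⟩

/-- Roots bounding a fundamental chamber: for each `D₄`-component the simple roots of the affine
root system of type `F₄`, followed by two roots of height one. -/
def simpleRoot : Fin 17 → Fin (2 + (4 + (4 + 4))) → ℤ :=
  ![![0, 0, -1, -1, -2, -2, 0, 0, 0, 0, 0, 0, 0, 0],
    ![0, 0, 0, 0, 0, 1, 0, 0, 0, 0, 0, 0, 0, 0],
    ![0, 0, 0, 0, 1, 0, 0, 0, 0, 0, 0, 0, 0, 0],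
    ![0, 0, 1, 2, 2, 1, 0, 0, 0, 0, 0, 0, 0, 0],
    ![0, 1, 1, -1, 0, 0, 0, 0, 0, 0, 0, 0, 0, 0],
    ![0, 0, 0, 0, 0, 0, -1, -1, -2, -2, 0, 0, 0, 0],
    ![0, 0, 0, 0, 0, 0, 0, 0, 0, 1, 0, 0, 0, 0],
    ![0, 0, 0, 0, 0, 0, 0, 0, 1, 0, 0, 0, 0, 0],
    ![0, 0, 0, 0, 0, 0, 1, 2, 2, 1, 0, 0, 0, 0],
    ![0, 1, 0, 0, 0, 0, 1, -1, 0, 0, 0, 0, 0, 0],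
    ![0, 0, 0, 0, 0, 0, 0, 0, 0, 0, -1, -1, -2, -2],
    ![0, 0, 0, 0, 0, 0, 0, 0, 0, 0, 0, 0, 0, 1],
    ![0, 0, 0, 0, 0, 0, 0, 0, 0, 0, 0, 0, 1, 0],
    ![0, 0, 0, 0, 0, 0, 0, 0, 0, 0, 1, 2, 2, 1],
    ![0, 1, 0, 0, 0, 0, 0, 0, 0, 0, 1, -1, 0, 0],
    ![1, -1, 0, 0, 0, 0, 0, 0, 0, 0, 0, 0, 0, 0],
    ![1, 1, 1, 0, 0, 0, 1, 0, 0, 0, 1, 0, 0, 0]]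

theorem isRoot_simpleRoot (i : Fin 17) : IsRoot gramS (simpleRoot i) := by
  have h : ∀ i, bform gramS (simpleRoot i) (simpleRoot i) = -2 ∨
      (bform gramS (simpleRoot i) (simpleRoot i) = -4 ∧
        ∀ j, 2 ∣ gramS.mulVec (simpleRoot i) j) := by
    rw [gramS_eq]
    decide
  refine (h i).imp_right fun h => ⟨h.1, fun x => ?_⟩
  rw [bform_comm _ _ _ gramS_isSymm]
  exact dvd_bform_of_dvd_mulVec x h.2

/-- A vector in the interior of the fundamental chamber. -/
def chamberVector : Fin (2 + (4 + (4 + 4))) → ℤ :=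
  ![9, 10, 7, -1, 3, 1, 7, -1, 3, 1, 7, -1, 3, 1]

theorem bform_chamberVector_simpleRoot_pos (i : Fin 17) :
    0 < bform gramS chamberVector (simpleRoot i) := by
  rw [gramS_eq]
  revert i
  decide

theorem bform_chamberVector : bform gramS chamberVector chamberVector = 126 := by
  rw [gramS_eq]
  decide

theorem isPos_chamberVector : IsPos chamberVector :=
  ⟨by rw [bform_chamberVector]; norm_num, by decide⟩

/-- On the cone over the fundamental alcove of affine `F₄`, the quadratic form
`m (a + b) - (a² + b² + c² + d²)` is nonnegative, and it is large away from the extremal rays. -/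
theorem alcove_bound {m a b c d : ℤ} (hd : 0 ≤ d) (hcd : d ≤ c) (hbc : c ≤ b)
    (ha : b + c + d ≤ a) (hm : a ≤ m) :
    0 ≤ m * (a + b) - (a ^ 2 + b ^ 2 + c ^ 2 + d ^ 2) ∧
    (m * (a + b) - (a ^ 2 + b ^ 2 + c ^ 2 + d ^ 2) ≠ 0 →
      m ≤ 3 * (m * (a + b) - (a ^ 2 + b ^ 2 + c ^ 2 + d ^ 2)) + 3) := by
  obtain ⟨s, rfl⟩ := Int.le.dest hcd
  obtain ⟨t, rfl⟩ := Int.le.dest hbc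
  obtain ⟨u, rfl⟩ := Int.le.dest ha
  obtain ⟨v, rfl⟩ := Int.le.dest hm
  obtain ⟨d, rfl⟩ := Int.eq_ofNat_of_zero_le hd
  have key : ((d + s + t + (d + s) + d + u + v : ℤ) * ((d + s + t + (d + s) + d + u) + (d + s + t))
      - ((d + s + t + (d + s) + d + u : ℤ) ^ 2 + (d + s + t : ℤ) ^ 2 + (d + s : ℤ) ^ 2 + d ^ 2)) =
      ((v * u + 2 * v * t + 3 * v * s + 4 * v * d + u * t + u * s + u * d + t * s + 2 * t * d
        + s * d : ℕ) : ℤ) := by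
    push_cast
    ring
  rw [key]
  refine ⟨by positivity, fun h => ?_⟩
  have h' : v * u + 2 * v * t + 3 * v * s + 4 * v * d + u * t + u * s + u * d + t * s + 2 * t * d
        + s * d ≠ 0 := by exact_mod_cast h
  have : d + s + t + (d + s) + d + u + v ≤ 3 * (v * u + 2 * v * t + 3 * v * s + 4 * v * d + u * t
      + u * s + u * d + t * s + 2 * t * d + s * d) + 3 := by
    clear key h
    rcases v with _ | v <;> rcases u with _ | u <;> rcases t with _ | t <;>
      rcases s with _ | s <;> rcases d with _ | d <;> simp at h' ⊢ <;> nlinarith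
  exact_mod_cast this

/-- In the fundamental chamber, both hyperbolic coordinates are bounded by the square. -/
theorem IsPos.le_of_mem_chamber {x : Fin (2 + (4 + (4 + 4))) → ℤ} (hx : IsPos x)
    (h : ∀ i, 0 ≤ bform gramS x (simpleRoot i)) :
    x 0 ≤ 4 * bform gramS x x + 3 ∧ x 1 ≤ 4 * bform gramS x x + 3 := by
  obtain ⟨hN, h0⟩ := hx
  simp only [bform_gramS, Fin.forall_fin_succ, Fin.forall_fin_zero] at h
  simp [Fin.succ, simpleRoot, eucl, dotProduct, Fin.sum_univ_succ] at h
  obtain ⟨d1, c1, b1, a1, m1, d2, c2, b2, a2, m2, d3, c3, b3, a3, m3, hmn, hh⟩ := h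
  have q1 := alcove_bound d1 c1 (b := x 2 + x 3 - x 4) (a := x 2 - x 3) (m := x 0)
    (by linarith) (by linarith) (by linarith)
  have q2 := alcove_bound d2 c2 (b := x 6 + x 7 - x 8) (a := x 6 - x 7) (m := x 0)
    (by linarith) (by linarith) (by linarith)
  have q3 := alcove_bound d3 c3 (b := x 10 + x 11 - x 12) (a := x 10 - x 11) (m := x 0)
    (by linarith) (by linarith) (by linarith)
  clear d1 c1 b1 a1 m1 d2 c2 b2 a2 m2 d3 c3 b3 a3 m3
  have hsum : bform gramS x x = 2 * x 0 * (x 1 - x 0) + x 0 * (2 * (x 0 + x 1) -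
      (x 2 - x 3 + (x 2 + x 3 - x 4 + (x 6 - x 7 + (x 6 + x 7 - x 8 +
        (x 10 - x 11 + (x 10 + x 11 - x 12))))))) +
      (x 0 * (x 2 - x 3 + (x 2 + x 3 - x 4)) -
        ((x 2 - x 3) ^ 2 + (x 2 + x 3 - x 4) ^ 2 + (x 4 - x 5) ^ 2 + x 5 ^ 2)) +
      (x 0 * (x 6 - x 7 + (x 6 + x 7 - x 8)) -
        ((x 6 - x 7) ^ 2 + (x 6 + x 7 - x 8) ^ 2 + (x 8 - x 9) ^ 2 + x 9 ^ 2)) +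
      (x 0 * (x 10 - x 11 + (x 10 + x 11 - x 12)) -
        ((x 10 - x 11) ^ 2 + (x 10 + x 11 - x 12) ^ 2 + (x 12 - x 13) ^ 2 + x 13 ^ 2)) := by
    rw [bform_gramS]
    simp [eucl, dotProduct, Fin.sum_univ_succ]
    ring
  rw [← sub_nonneg] at hh hmn
  generalize x 0 * (x 2 - x 3 + (x 2 + x 3 - x 4)) -
    ((x 2 - x 3) ^ 2 + (x 2 + x 3 - x 4) ^ 2 + (x 4 - x 5) ^ 2 + x 5 ^ 2) = Q1 at *
  generalize x 0 * (x 6 - x 7 + (x 6 + x 7 - x 8)) -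
    ((x 6 - x 7) ^ 2 + (x 6 + x 7 - x 8) ^ 2 + (x 8 - x 9) ^ 2 + x 9 ^ 2) = Q2 at *
  generalize x 0 * (x 10 - x 11 + (x 10 + x 11 - x 12)) -
    ((x 10 - x 11) ^ 2 + (x 10 + x 11 - x 12) ^ 2 + (x 12 - x 13) ^ 2 + x 13 ^ 2) = Q3 at *
  generalize 2 * (x 0 + x 1) - _ = R at *
  obtain ⟨k, hk⟩ : ∃ k, x 1 = x 0 + k := ⟨x 1 - x 0, by ring⟩
  rw [hk, add_sub_cancel_left] at hsum hmn
  rw [hk]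
  have hR := mul_nonneg h0.le hh
  have hK := mul_nonneg h0.le hmn
  have hkN : k ≤ x 0 * k := by nlinarith
  have hm : x 0 ≤ 3 * bform gramS x x + 3 := by
    by_cases h1 : Q1 = 0
    · by_cases h2 : Q2 = 0
      · by_cases h3 : Q3 = 0
        · rcases hmn.eq_or_lt with hk0 | hk0
          · rcases hh.eq_or_lt with hR0 | hR0
            · rw [h1, h2, h3, ← hk0, ← hR0] at hsum
              simp at hsum
              omega
            · nlinarith
          · nlinarith
        · linarith [q3.2 h3]
      · linarith [q2.2 h2]
    · linarith [q1.2 h1]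
  constructor <;> linarith

theorem exists_Wr_mem_chamber {x : Fin (2 + (4 + (4 + 4))) → ℤ} (hx : IsPos x) :
    ∃ w ∈ Wr _ gramS, IsPos (w.1 x) ∧ ∀ i, 0 ≤ bform gramS (w.1 x) (simpleRoot i) := by
  induction hk : (bform gramS x chamberVector).toNat using Nat.strong_induction_on
    generalizing x with
  | _ k ih =>
  by_cases h : ∀ i, 0 ≤ bform gramS x (simpleRoot i)
  · exact ⟨1, one_mem _, hx, h⟩
  · push Not at h
    obtain ⟨i, hi⟩ := h
    have hα := isRoot_simpleRoot i
    have hpos := hx.reflectFun hα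
    have hlt : bform gramS (reflectFun gramS (simpleRoot i) x) chamberVector <
        bform gramS x chamberVector := by
      have h1 := hα.ediv_mul gramS_isSymm x
      have h2 := hα.bform_neg
      have h3 := bform_chamberVector_simpleRoot_pos i
      rw [bform_comm _ _ _ gramS_isSymm] at h3
      rw [reflectFun, bform_sub_left, bform_smul_left]
      have : 0 < 2 * bform gramS x (simpleRoot i) /
        bform gramS (simpleRoot i) (simpleRoot i) := by nlinarith
      linarith [mul_pos this h3]
    have h4 := hpos.bform_pos isPos_chamberVector
    obtain ⟨w, hw, hw'⟩ := ih _ (by omega) hpos rfl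
    exact ⟨w * reflection gramS_isSymm hα, mul_mem hw (reflection_mem_Wr _ hα), hw'⟩

theorem finite_isPos_bform_le (u : Fin (2 + (4 + (4 + 4))) → ℤ) (hu : IsPos u) (c : ℤ) :
    {x | IsPos x ∧ bform gramS x u ≤ c}.Finite := by
  set e : Fin (2 + (4 + (4 + 4))) → ℤ := Pi.single 0 1 + Pi.single 1 1 with he
  have hee : bform gramS e e = 4 := by rw [he, gramS_eq]; decide
  have hxe : ∀ x, bform gramS x e = 2 * (x 0 + x 1) := fun x => by
    simp [bform_gramS, he, eucl, dotProduct, Fin.sum_univ_succ]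
  have hu1 := hu.one_pos
  have hu0 := hu.2
  set K := 4 * (u 0 + u 1) + 1 with hK
  have hw : ∀ x, bform gramS x (K • u - e) = K * bform gramS x u - bform gramS x e := fun x => by
    rw [bform_comm _ _ _ gramS_isSymm, bform_sub_left, bform_smul_left,
      bform_comm _ u x gramS_isSymm, bform_comm _ e x gramS_isSymm]
  have hpos : IsPos (K • u - e) := by
    constructor
    · rw [hw, bform_sub_left, bform_sub_left, bform_smul_left, bform_smul_left,
        bform_comm _ e u gramS_isSymm, hee, hxe]
      have hKN : K * K ≤ K * (K * bform gramS u u) := by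
        have : 0 < K := by omega
        have : 1 ≤ bform gramS u u := hu.1
        nlinarith [mul_pos ‹0 < K› ‹0 < K›]
      nlinarith
    · simp [he]
      nlinarith
  refine (finite_isPos_le (K * c)).subset ?_
  rintro x ⟨hx, hxc⟩
  have h := hx.bform_pos hpos
  rw [hw, hxe] at h
  have hx0 := hx.2
  have hx1 := hx.one_pos
  have : K * bform gramS x u ≤ K * c := by gcongr
  exact ⟨hx, by linarith, by linarith⟩

/-- An isometry keeping one vector of the positive half-cone inside it preserves the half-cone. -/
theorem IsPos.map {u x : Fin (2 + (4 + (4 + 4))) → ℤ} (hu : IsPos u) (hx : IsPos x)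
    (g : OrthGroup _ gramS) (hgu : IsPos (g.1 u)) : IsPos (g.1 x) :=
  hgu.of_bform_pos ((g.2 x x).symm ▸ hx.1) ((g.2 u x).symm ▸ hu.bform_pos hx)

theorem exists_isPos_add_smul {u : Fin (2 + (4 + (4 + 4))) → ℤ} (hu : IsPos u)
    (x : Fin (2 + (4 + (4 + 4))) → ℤ) : ∃ k : ℤ, IsPos (x + k • u) := by
  refine ⟨2 * |bform gramS x u| + |bform gramS x x| + |x 0| + 1, ?_⟩
  have h1 := neg_abs_le (bform gramS x u)
  have h2 := neg_abs_le (bform gramS x x)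
  have h3 := neg_abs_le (x 0)
  have h4 := abs_nonneg (bform gramS x u)
  have h5 := abs_nonneg (bform gramS x x)
  have h6 := abs_nonneg (x 0)
  set k := 2 * |bform gramS x u| + |bform gramS x x| + |x 0| + 1
  have hu0 := hu.2
  constructor
  · rw [bform_add_left, bform_smul_left, bform_comm _ x _ gramS_isSymm,
      bform_comm _ u _ gramS_isSymm,
      bform_add_left, bform_add_left, bform_smul_left, bform_smul_left,
      bform_comm _ u x gramS_isSymm]
    have hk : 1 ≤ k := by omega
    have : k * k ≤ k * (k * bform gramS u u) := by
      nlinarith [hu.1, mul_pos (show 0 < k by omega) (show 0 < k by omega)]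
    nlinarith
  · simp
    nlinarith

/-- Only finitely many isometries map a given positive vector into a given finite set of
positive vectors. -/
theorem finite_orthGroup_maps {u : Fin (2 + (4 + (4 + 4))) → ℤ} (hu : IsPos u)
    {F : Set (Fin (2 + (4 + (4 + 4))) → ℤ)} (hF : F.Finite) (hpos : ∀ y ∈ F, IsPos y) :
    {g : OrthGroup _ gramS | g.1 u ∈ F}.Finite := by
  have hx : ∀ x, {y | ∃ g : OrthGroup _ gramS, g.1 u ∈ F ∧ g.1 x = y}.Finite := by
    intro x
    obtain ⟨k, hk⟩ := exists_isPos_add_smul hu x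
    have hfin := hF.biUnion fun v hv =>
      (finite_isPos_bform_le v (hpos v hv) (bform gramS (x + k • u) u)).image fun z => z - k • v
    refine hfin.subset ?_
    rintro y ⟨g, hg, rfl⟩
    simp only [Set.mem_iUnion]
    exact ⟨g.1 u, hg, g.1 (x + k • u), ⟨hu.map hk g (hpos _ hg), (g.2 _ _).le⟩,
      by simp only [map_add, map_smul, add_sub_cancel_right]⟩
  refine Set.Finite.of_finite_image (f := fun g i => g.1 (Pi.single i 1))
    ((Set.Finite.pi' fun i => hx (Pi.single i 1)).subset ?_) ?_
  · rintro _ ⟨g, hg, rfl⟩ i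
    exact ⟨g, hg, rfl⟩
  · intro g _ g' _ h
    refine Subtype.ext (LinearEquiv.toLinearMap_injective ?_)
    refine LinearMap.pi_ext' fun i => LinearMap.ext_ring ?_
    exact congrFun h i

theorem Subgroup.finiteIndex_of_finite_mul {H : Type*} [Group H] {W : Subgroup H} {T : Set H}
    (hT : T.Finite) (h : ∀ g, ∃ w ∈ W, w * g ∈ T) : W.FiniteIndex := by
  have : Finite T := hT
  have : Finite (H ⧸ W) := by
    refine Finite.of_surjective (fun t : T => QuotientGroup.mk (s := W) (t : H)⁻¹) fun q => ?_
    obtain ⟨g, rfl⟩ := QuotientGroup.mk_surjective q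
    obtain ⟨w, hw, hT⟩ := h g⁻¹
    refine ⟨⟨_, hT⟩, ?_⟩
    rw [QuotientGroup.eq]
    simpa using hw
  exact Subgroup.finiteIndex_of_finite_quotient

/-- The isometry `-1`. -/
def negIsometry {n : ℕ} (G : Matrix (Fin n) (Fin n) ℤ) : OrthGroup n G :=
  ⟨LinearEquiv.neg ℤ, fun x y => by simp [bform, mulVec_neg]⟩

theorem isPos_or_isPos_neg {x : Fin (2 + (4 + (4 + 4))) → ℤ} (hx : 0 < bform gramS x x) :
    IsPos x ∨ IsPos (-x) := by
  rcases lt_trichotomy (x 0) 0 with h | h | h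
  · refine .inr ⟨?_, by simpa using h⟩
    rwa [bform_neg_left, bform_comm _ _ _ gramS_isSymm, bform_neg_left, neg_neg]
  · rw [bform_gramS, h] at hx
    have : 0 ≤ eucl x ⬝ᵥ eucl x := Finset.sum_nonneg fun i _ => mul_self_nonneg _
    linarith
  · exact .inl ⟨hx, h⟩

/-- The lattice `U(2) ⊕ D₄ ⊕ D₄ ⊕ D₄` is reflective: the subgroup `W_r` of `O(S)`
generated by the reflections in all roots has finite index in `O(S)`. -/
theorem reflective_14_8_0 : (Wr _ gramS).FiniteIndex := by
  have hF := finite_isPos_le (4 * bform gramS chamberVector chamberVector + 3)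
  have hT := finite_orthGroup_maps isPos_chamberVector hF fun y hy => hy.1
  have hex : ∀ g : OrthGroup _ gramS, IsPos (g.1 chamberVector) →
      ∃ w ∈ Wr _ gramS, w * g ∈ {g : OrthGroup _ gramS | g.1 chamberVector ∈
        {x | IsPos x ∧ x 0 ≤ 4 * bform gramS chamberVector chamberVector + 3 ∧
          x 1 ≤ 4 * bform gramS chamberVector chamberVector + 3}} := by
    intro g hg
    obtain ⟨w, hw, hpos, hch⟩ := exists_Wr_mem_chamber hg
    have := hpos.le_of_mem_chamber hch
    rw [w.2, g.2] at this
    exact ⟨w, hw, hpos, this⟩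
  refine Subgroup.finiteIndex_of_finite_mul (hT.union (hT.image (· * negIsometry gramS)))
    fun g => ?_
  have hN : 0 < bform gramS (g.1 chamberVector) (g.1 chamberVector) := by
    rw [g.2]
    exact isPos_chamberVector.1
  rcases isPos_or_isPos_neg hN with h | h
  · obtain ⟨w, hw, h⟩ := hex g h
    exact ⟨w, hw, .inl h⟩
  · have hg : IsPos ((g * negIsometry gramS).1 chamberVector) := by
      simpa [negIsometry] using h
    obtain ⟨w, hw, h⟩ := hex _ hg
    refine ⟨w, hw, .inr ⟨_, h, ?_⟩⟩
    have : negIsometry gramS * negIsometry gramS = 1 :=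
      Subtype.ext (LinearEquiv.ext fun x => neg_neg x)
    simp [mul_assoc, this]
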